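/- Suppose $f : \mathbb{R}^D \to \mathbb{R}$ is continuously differentiable, $\nabla f$ is continuous, and there exists a polynomial $p_1$ of degree at most $M-1$ with non-negative coefficients (where $M \geq 2$) such that at every point where the Hessian exists, $\|\nabla^2 f(\theta)\theta - (M-1)\nabla f(\theta)\| \leq p_1'(\|\theta\|)$; assume also $\nabla f$ is locally Lipschitz. Then there exists a polynomial $p$ of degree at most $M$ with non-negative coefficients and a constant $C$ such that $|\langle \nabla f(\theta), \theta\rangle - M f(\theta)| \leq p'(\|\theta\|) + C$ for all $\theta$. -/

import Mathlib

open Finset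
open scoped RealInnerProductSpace

open MeasureTheory

/-- *Rademacher's theorem* for locally Lipschitz functions. -/
theorem LocallyLipschitz.ae_differentiableAt {E F : Type*} [NormedAddCommGroup E]
    [NormedSpace ℝ E] [FiniteDimensional ℝ E] [MeasurableSpace E] [BorelSpace E]
    [NormedAddCommGroup F] [NormedSpace ℝ F] [FiniteDimensional ℝ F]
    {μ : Measure E} [μ.IsAddHaarMeasure] {g : E → F} (hg : LocallyLipschitz g) :
    ∀ᵐ x ∂μ, DifferentiableAt ℝ g x := by
  have : ProperSpace E := FiniteDimensional.proper ℝ E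
  rw [ae_iff]
  refine measure_null_of_locally_null _ fun x _ => ?_
  obtain ⟨K, t, ht, hK⟩ := hg x
  refine ⟨interior t ∩ {y | ¬ DifferentiableAt ℝ g y},
    Filter.inter_mem (mem_nhdsWithin_of_mem_nhds (interior_mem_nhds.2 ht)) self_mem_nhdsWithin, ?_⟩
  refine measure_mono_null (fun y hy => ?_) (ae_iff.1 (hK.ae_differentiableWithinAt_of_mem (μ := μ)))
  exact fun h => hy.2 <|
    (h (interior_subset hy.1)).differentiableAt (mem_interior_iff_mem_nhds.1 hy.1)

/-- A property holding almost everywhere holds at almost every point of almost every line through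
the origin. -/
theorem ae_ae_smul_of_ae {E : Type*} [NormedAddCommGroup E] [NormedSpace ℝ E]
    [FiniteDimensional ℝ E] [MeasurableSpace E] [BorelSpace E] {μ : Measure E}
    [μ.IsAddHaarMeasure] {p : E → Prop} (hp : ∀ᵐ x ∂μ, p x) :
    ∀ᵐ x ∂μ, ∀ᵐ s : ℝ, p (s • x) := by
  have : ProperSpace E := FiniteDimensional.proper ℝ E
  obtain ⟨t, htp, ht, hμt⟩ := exists_measurable_superset_of_null (ae_iff.1 hp)
  have hmeas : MeasurableSet {z : ℝ × E | z.1 • z.2 ∈ tᶜ} :=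
    (measurable_fst.smul measurable_snd) ht.compl
  have hslice : ∀ᵐ s : ℝ, ∀ᵐ x ∂μ, s • x ∈ tᶜ := by
    filter_upwards [Measure.ae_ne volume (0 : ℝ)] with s hs
    exact (Measure.quasiMeasurePreserving_smul μ hs).ae (measure_eq_zero_iff_ae_notMem.1 hμt)
  filter_upwards [(Measure.ae_ae_comm hmeas).1 hslice] with x hx
  filter_upwards [hx] with s hs
  by_contra h
  exact hs (htp h)

/-- A locally Lipschitz function whose radial derivative is dominated almost everywhere by that of
`P ‖x‖` has radial increments dominated by those of `P`. -/
theorem LocallyLipschitz.abs_sub_le_of_ae_abs_fderiv_self_le {E : Type*} [NormedAddCommGroup E]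
    [NormedSpace ℝ E] [FiniteDimensional ℝ E] [MeasurableSpace E] [BorelSpace E]
    {μ : Measure E} [μ.IsAddHaarMeasure] {g : E → ℝ} (hg : LocallyLipschitz g)
    {P P' : ℝ → ℝ} (hP : ∀ r, HasDerivAt P (P' r) r) (hP' : Continuous P')
    (hbound : ∀ᵐ x ∂μ, |fderiv ℝ g x x| ≤ P' ‖x‖ * ‖x‖) (x : E) :
    |g x - g 0| ≤ P ‖x‖ - P 0 := by
  have hPc : Continuous P := continuous_iff_continuousAt.2 fun r => (hP r).continuousAt
  have hdense : Dense {x | |g x - g 0| ≤ P ‖x‖ - P 0} := by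
    refine Measure.dense_of_ae (μ := μ) ?_
    filter_upwards [ae_ae_smul_of_ae (hg.ae_differentiableAt.and hbound)] with x hx
    have hline (s : ℝ) : HasDerivAt (fun s : ℝ => s • x) x s := by
      simpa using (hasDerivAt_id s).smul_const x
    have hloc : LocallyLipschitz fun s : ℝ => g (s • x) :=
      hg.comp (contDiff_id.smul contDiff_const : ContDiff ℝ 1 fun s : ℝ => s • x).locallyLipschitz
    obtain ⟨K, hK⟩ := hloc.locallyLipschitzOn.exists_lipschitzOnWith_of_compact
      (isCompact_uIcc (a := (0 : ℝ)) (b := 1))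
    have hftc := hK.absolutelyContinuousOnInterval.integral_deriv_eq_sub
    have hcont : Continuous fun s : ℝ => P' (s * ‖x‖) * ‖x‖ := by fun_prop
    have hint : ∫ s in (0 : ℝ)..1, P' (s * ‖x‖) * ‖x‖ = P ‖x‖ - P 0 := by
      rw [intervalIntegral.integral_eq_sub_of_hasDerivAt (f := fun s => P (s * ‖x‖))
        (fun s _ => ?_) (hcont.intervalIntegrable _ _)]
      · simp
      · exact (hP _).comp s (by simpa using (hasDerivAt_id s).mul_const ‖x‖)
    simp only [one_smul, zero_smul] at hftc
    rw [← hftc, ← hint, ← Real.norm_eq_abs]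
    refine intervalIntegral.norm_integral_le_of_norm_le zero_le_one ?_
      (hcont.intervalIntegrable _ _)
    filter_upwards [hx] with s hs hs01
    have hs0 : 0 < s := hs01.1
    have hderiv : deriv (fun s : ℝ => g (s • x)) s = fderiv ℝ g (s • x) x :=
      (hs.1.hasFDerivAt.comp_hasDerivAt s (hline s)).deriv
    have h := hs.2
    rw [map_smul, smul_eq_mul, abs_mul, norm_smul, Real.norm_eq_abs, abs_of_pos hs0] at h
    rw [hderiv, Real.norm_eq_abs]
    exact le_of_mul_le_mul_left (by linarith) hs0
  have hclosed : IsClosed {x | |g x - g 0| ≤ P ‖x‖ - P 0} :=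
    isClosed_le (by have := hg.continuous; fun_prop) (by fun_prop)
  exact hclosed.closure_subset (hdense x)

/-- If `f` is `C¹` with locally Lipschitz gradient and the gradient is
near-`(M-1)`-homogeneous in the sense that wherever the Hessian exists,
`‖∇²f(θ)θ - (M-1)∇f(θ)‖ ≤ p₁'(‖θ‖)` with `deg p₁ ≤ M-1` and non-negative coefficients,
then `f` is near-`M`-homogeneous: there exist a polynomial `p` with non-negative
coefficients of degree at most `M` and a constant `C` with
`|⟨∇f(θ),θ⟩ - M f(θ)| ≤ p'(‖θ‖) + C`. -/
theorem stmt16 (D M : ℕ) (hM : 2 ≤ M) (f : EuclideanSpace ℝ (Fin D) → ℝ)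
    (hf : ContDiff ℝ 1 f) (hlip : LocallyLipschitz (gradient f))
    (p1 : ℕ → ℝ) (hp1 : ∀ i, 0 ≤ p1 i)
    (hhess : ∀ θ, DifferentiableAt ℝ (gradient f) θ →
      ‖(fderiv ℝ (gradient f) θ) θ - ((M : ℝ) - 1) • gradient f θ‖ ≤
        ∑ i ∈ Icc 1 (M - 1), (i : ℝ) * p1 i * ‖θ‖ ^ (i - 1)) :
    ∃ (b : ℕ → ℝ) (C : ℝ), (∀ i, 0 ≤ b i) ∧
      ∀ θ, |⟪gradient f θ, θ⟫ - (M : ℝ) * f θ| ≤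
        (∑ i ∈ Icc 1 M, (i : ℝ) * b i * ‖θ‖ ^ (i - 1)) + C := by
  set G : EuclideanSpace ℝ (Fin D) → ℝ := fun θ => ⟪gradient f θ, θ⟫ - (M : ℝ) * f θ
  have hG : LocallyLipschitz G := by
    have hsmooth : ContDiff ℝ 1
        fun z : EuclideanSpace ℝ (Fin D) × EuclideanSpace ℝ (Fin D) =>
          ⟪z.1, z.2⟫ - (M : ℝ) * f z.2 :=
      (contDiff_fst.inner ℝ contDiff_snd).sub (contDiff_const.mul (hf.comp contDiff_snd))
    exact hsmooth.locallyLipschitz.comp (g := fun θ => (gradient f θ, θ))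
      (hlip.prodMk LocallyLipschitz.id)
  have hfderiv (θ) (hθ : DifferentiableAt ℝ (gradient f) θ) :
      fderiv ℝ G θ θ = ⟪fderiv ℝ (gradient f) θ θ - ((M : ℝ) - 1) • gradient f θ, θ⟫ := by
    have hgrad : HasFDerivAt f (InnerProductSpace.toDual ℝ _ (gradient f θ)) θ :=
      (hf.differentiable one_ne_zero θ).hasGradientAt.hasFDerivAt
    have hGθ := (hθ.hasFDerivAt.inner ℝ (hasFDerivAt_id θ)).sub (hgrad.const_mul (M : ℝ))
    rw [show fderiv ℝ G θ = _ from hGθ.fderiv]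
    simp [inner_sub_left, inner_smul_left]
    ring
  have hP (r : ℝ) : HasDerivAt (fun r => ∑ i ∈ Icc 1 (M - 1), p1 i * r ^ i)
      (∑ i ∈ Icc 1 (M - 1), (i : ℝ) * p1 i * r ^ (i - 1)) r := by
    refine HasDerivAt.fun_sum fun i _ => ?_
    exact ((hasDerivAt_pow i r).const_mul (p1 i)).congr_deriv (by ring)
  have hbound : ∀ᵐ θ, |fderiv ℝ G θ θ| ≤
      (∑ i ∈ Icc 1 (M - 1), (i : ℝ) * p1 i * ‖θ‖ ^ (i - 1)) * ‖θ‖ := by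
    filter_upwards [hlip.ae_differentiableAt] with θ hθ
    rw [hfderiv θ hθ]
    exact (abs_real_inner_le_norm _ _).trans (by gcongr; exact hhess θ hθ)
  refine ⟨fun i => p1 (i - 1) / i, |G 0|, fun i => div_nonneg (hp1 _) i.cast_nonneg, fun θ => ?_⟩
  have hθ := hG.abs_sub_le_of_ae_abs_fderiv_self_le hP (by fun_prop) hbound θ
  have hzero : ∑ i ∈ Icc 1 (M - 1), p1 i * (0 : ℝ) ^ i = 0 :=
    sum_eq_zero fun i hi => by simp [Nat.one_le_iff_ne_zero.1 (mem_Icc.1 hi).1]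
  have hsum : ∑ i ∈ Icc 1 (M - 1), p1 i * ‖θ‖ ^ i ≤
      ∑ i ∈ Icc 1 M, (i : ℝ) * (p1 (i - 1) / i) * ‖θ‖ ^ (i - 1) := by
    have hshift : ∑ i ∈ Icc 1 M, (i : ℝ) * (p1 (i - 1) / i) * ‖θ‖ ^ (i - 1) =
        ∑ i ∈ range M, p1 i * ‖θ‖ ^ i := by
      rw [range_eq_Ico, ← sum_Ico_add_right_sub_eq (a := 0) M 1]
      refine sum_congr (by ext; simp) fun i hi => ?_
      have : (i : ℝ) ≠ 0 := by
        have := (mem_Icc.1 hi).1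
        positivity
      field_simp
    rw [hshift]
    refine sum_le_sum_of_subset_of_nonneg (fun i hi => ?_) fun i _ _ => ?_
    · simp only [mem_Icc, mem_range] at hi ⊢
      omega
    · have := hp1 i
      positivity
  have htri : |G θ| ≤ |G θ - G 0| + |G 0| := by simpa using abs_add_le (G θ - G 0) (G 0)
  change |G θ| ≤ _
  linarith
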